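/- Let Ω = O(n) × 𝔇 and let f : Ω → ℝ^{n×n×n×n} be the map f(Q, S) = S ×₁Q ×₂Q ×₃Q ×₄Q, with Df_u denoting its Jacobian at u. Suppose ‖S‖_F ≤ R for all points considered, and let C₁ = n²(n+1)²·max{3R, 1}. Then for all u, u' ∈ Ω with ‖u − u'‖₂ ≤ 2ε₀, the Jacobian is Lipschitz: ‖Df_u − Df_{u'}‖_F ≤ 2C₁ · ‖u − u'‖₂. -/

import Mathlib

open scoped BigOperators
open MeasureTheory ProbabilityTheory Matrix
open scoped NNReal ENNReal

noncomputable section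

/-- 4th-order tensors over ℝⁿ. -/
abbrev T4 (n : ℕ) := Fin n → Fin n → Fin n → Fin n → ℝ

/-- Squared Frobenius norm of a 4th-order tensor. -/
def frobSq {n : ℕ} (S : T4 n) : ℝ := ∑ i, ∑ j, ∑ k, ∑ l, (S i j k l) ^ 2

/-- Frobenius norm of a 4th-order tensor. -/
def frob {n : ℕ} (S : T4 n) : ℝ := Real.sqrt (frobSq S)

/-- Vectorization of a 4th-order tensor. -/
def tvec {n : ℕ} (S : T4 n) : Fin n × Fin n × Fin n × Fin n → ℝ :=
  fun x => S x.1 x.2.1 x.2.2.1 x.2.2.2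

/-- Squared Euclidean norm. -/
def l2Sq {ι : Type*} [Fintype ι] (v : ι → ℝ) : ℝ := ∑ i, (v i) ^ 2

/-- Euclidean norm. -/
def l2 {ι : Type*} [Fintype ι] (v : ι → ℝ) : ℝ := Real.sqrt (l2Sq v)

/-- Multilinear transform of a 4th-order tensor by four matrices. -/
def mulT {n : ℕ} (S : T4 n) (A B C D : Matrix (Fin n) (Fin n) ℝ) : T4 n :=
  fun i j k l => ∑ p, ∑ q, ∑ r, ∑ s, A i p * B j q * C k r * D l s * S p q r s

/-- Diagonal 4th-order tensors with diagonal entries at least `εS`. -/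
def IsDiagT {n : ℕ} (εS : ℝ) (S : T4 n) : Prop :=
  (∀ i j k l, ¬ (j = i ∧ k = i ∧ l = i) → S i j k l = 0) ∧ ∀ i, εS ≤ S i i i i

/-- The ICA model set. -/
def ICAset (n : ℕ) (εS : ℝ) : Set (T4 n) :=
  { Z | ∃ S Q, IsDiagT εS S ∧ Qᵀ * Q = 1 ∧ Z = mulT S Q Q Q Q }

/-- The i.i.d.-Gaussian-entries (mean 0, variance 1/m) measure on m×p matrices,
with p indexed by 4-tuples. -/
def gaussMat (m n : ℕ) :
    Measure (Fin m → (Fin n × Fin n × Fin n × Fin n) → ℝ) :=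
  Measure.pi fun _ : Fin m =>
    Measure.pi fun _ : Fin n × Fin n × Fin n × Fin n =>
      gaussianReal 0 ((m : ℝ≥0))⁻¹

/-- The restricted isometry property with constant δ on the ICA model set. -/
def RIPset (n m : ℕ) (εS δ : ℝ) :
    Set (Fin m → (Fin n × Fin n × Fin n × Fin n) → ℝ) :=
  { A | ∀ Z₁ ∈ ICAset n εS, ∀ Z₂ ∈ ICAset n εS,
      (1 - δ) * frobSq (Z₁ - Z₂) ≤ l2Sq ((Matrix.of A).mulVec (tvec (Z₁ - Z₂))) ∧
      l2Sq ((Matrix.of A).mulVec (tvec (Z₁ - Z₂))) ≤ (1 + δ) * frobSq (Z₁ - Z₂) }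


/-- The diagonal 4th-order tensor with diagonal entries `d`. -/
def diagT {n : ℕ} (d : Fin n → ℝ) : T4 n :=
  fun i j k l => if j = i ∧ k = i ∧ l = i then d i else 0

/-- The parametrization map f(Q,S) = S ×₁Q ×₂Q ×₃Q ×₄Q, viewed as a smooth map on
the n² entries of Q and the n diagonal entries of S. -/
def Fmap {n : ℕ} (u : (Fin n → Fin n → ℝ) × (Fin n → ℝ)) : T4 n :=
  mulT (diagT u.2) (Matrix.of u.1) (Matrix.of u.1) (Matrix.of u.1) (Matrix.of u.1)

/-- Squared Euclidean norm ‖u‖₂² = ‖Q‖_F² + ‖S‖₂² on the parameter space. -/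
def paramNormSq {n : ℕ} (u : (Fin n → Fin n → ℝ) × (Fin n → ℝ)) : ℝ :=
  (∑ i, ∑ j, (u.1 i j) ^ 2) + ∑ i, (u.2 i) ^ 2

/-- Euclidean norm on the parameter space. -/
def paramNorm {n : ℕ} (u : (Fin n → Fin n → ℝ) × (Fin n → ℝ)) : ℝ :=
  Real.sqrt (paramNormSq u)

/-- Membership in Ω = O(n) × 𝔇. -/
def inOmega {n : ℕ} (εS : ℝ) (u : (Fin n → Fin n → ℝ) × (Fin n → ℝ)) : Prop :=
  (Matrix.of u.1)ᵀ * Matrix.of u.1 = 1 ∧ ∀ i, εS ≤ u.2 i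

/-- The coordinate direction corresponding to the matrix entry Q_{ij}. -/
def dirQ {n : ℕ} (i j : Fin n) : (Fin n → Fin n → ℝ) × (Fin n → ℝ) :=
  (fun a b => if a = i ∧ b = j then (1 : ℝ) else 0, 0)

/-- The coordinate direction corresponding to the diagonal entry S_{kkkk}. -/
def dirS {n : ℕ} (k : Fin n) : (Fin n → Fin n → ℝ) × (Fin n → ℝ) :=
  (0, Pi.single k 1)

/-- Frobenius norm of a Jacobian (a linear map from the parameter space to the
space of 4th-order tensors): the square root of the sum of the squared Frobenius
norms of its values on the standard orthonormal basis of the parameter space. -/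
def jacFrob {n : ℕ} (L : ((Fin n → Fin n → ℝ) × (Fin n → ℝ)) →L[ℝ] T4 n) : ℝ :=
  Real.sqrt ((∑ i, ∑ j, frobSq (L (dirQ i j))) + ∑ k, frobSq (L (dirS k)))

/-- The rank-one tensor `a ⊗ b ⊗ c ⊗ d`. -/
def outerT {n : ℕ} (a b c d : Fin n → ℝ) : T4 n :=
  fun i j k l => a i * b j * c k * d l

section

variable {n : ℕ}

lemma l2Sq_nonneg {ι : Type*} [Fintype ι] (v : ι → ℝ) : 0 ≤ l2Sq v :=
  Finset.sum_nonneg fun _ _ => sq_nonneg _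

lemma frobSq_outerT (a b c d : Fin n → ℝ) :
    frobSq (outerT a b c d) = l2Sq a * l2Sq b * l2Sq c * l2Sq d := by
  simp only [frobSq, outerT, l2Sq, mul_pow, ← Finset.mul_sum, ← Finset.sum_mul]

lemma frobSq_smul (s : ℝ) (A : T4 n) : frobSq (s • A) = s ^ 2 * frobSq A := by
  simp only [frobSq, Pi.smul_apply, smul_eq_mul, mul_pow, ← Finset.mul_sum]

lemma frobSq_sum_le {m : ℕ} (A : Fin m → T4 n) :
    frobSq (∑ x, A x) ≤ m * ∑ x, frobSq (A x) := by
  have key : ∑ x, frobSq (A x) = ∑ i, ∑ j, ∑ k, ∑ l, ∑ x, (A x i j k l) ^ 2 := by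
    simp only [frobSq]
    rw [Finset.sum_comm]; refine Finset.sum_congr rfl fun i _ => ?_
    rw [Finset.sum_comm]; refine Finset.sum_congr rfl fun j _ => ?_
    rw [Finset.sum_comm]; refine Finset.sum_congr rfl fun k _ => ?_
    rw [Finset.sum_comm]
  rw [key]
  simp only [frobSq, Finset.mul_sum, Finset.sum_apply]
  refine Finset.sum_le_sum fun i _ => Finset.sum_le_sum fun j _ =>
    Finset.sum_le_sum fun k _ => Finset.sum_le_sum fun l _ => ?_
  rw [← Finset.mul_sum]
  simpa using sq_sum_le_card_mul_sum_sq (s := Finset.univ) (f := fun x => A x i j k l)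

lemma frobSq_add_le (A B : T4 n) : frobSq (A + B) ≤ 2 * (frobSq A + frobSq B) := by
  simpa [Fin.sum_univ_two] using frobSq_sum_le ![A, B]

lemma frobSq_add_four_le (A B C D : T4 n) :
    frobSq (A + B + C + D) ≤ 4 * (frobSq A + frobSq B + frobSq C + frobSq D) := by
  simpa [Fin.sum_univ_four] using frobSq_sum_le ![A, B, C, D]

lemma frobSq_outerT_sub_le {a b c d a' b' c' d' : Fin n → ℝ}
    (hb : l2Sq b = 1) (hc : l2Sq c = 1) (hd : l2Sq d = 1)
    (ha' : l2Sq a' = 1) (hb' : l2Sq b' = 1) (hc' : l2Sq c' = 1) :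
    frobSq (outerT a b c d - outerT a' b' c' d') ≤
      4 * (l2Sq (a - a') + l2Sq (b - b') + l2Sq (c - c') + l2Sq (d - d')) := by
  have h : outerT a b c d - outerT a' b' c' d' =
      outerT (a - a') b c d + outerT a' (b - b') c d + outerT a' b' (c - c') d +
        outerT a' b' c' (d - d') := by
    ext i j k l
    simp only [outerT, Pi.sub_apply, Pi.add_apply]
    ring
  rw [h]
  refine (frobSq_add_four_le _ _ _ _).trans_eq ?_
  simp only [frobSq_outerT, hb, hc, hd, ha', hb', hc', one_mul, mul_one]

lemma frobSq_smul_outerT_sub_le {a b c d a' b' c' d' : Fin n → ℝ} (s s' : ℝ)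
    (ha : l2Sq a = 1) (hb : l2Sq b = 1) (hc : l2Sq c = 1) (hd : l2Sq d = 1)
    (ha' : l2Sq a' = 1) (hb' : l2Sq b' = 1) (hc' : l2Sq c' = 1) :
    frobSq (s • outerT a b c d - s' • outerT a' b' c' d') ≤
      2 * ((s - s') ^ 2 + s' ^ 2 *
        (4 * (l2Sq (a - a') + l2Sq (b - b') + l2Sq (c - c') + l2Sq (d - d')))) := by
  have h : s • outerT a b c d - s' • outerT a' b' c' d' =
      (s - s') • outerT a b c d + s' • (outerT a b c d - outerT a' b' c' d') := by
    module
  rw [h]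
  refine (frobSq_add_le _ _).trans ?_
  rw [frobSq_smul, frobSq_smul, frobSq_outerT, ha, hb, hc, hd]
  have := mul_le_mul_of_nonneg_left
    (frobSq_outerT_sub_le (a := a) (d' := d') hb hc hd ha' hb' hc') (sq_nonneg s')
  linarith

lemma Fmap_apply (u : (Fin n → Fin n → ℝ) × (Fin n → ℝ)) (i j k l : Fin n) :
    Fmap u i j k l = ∑ p, u.1 i p * u.1 j p * u.1 k p * u.1 l p * u.2 p := by
  simp [Fmap, mulT, diagT, ite_and]

lemma differentiable_Fmap : Differentiable ℝ (Fmap (n := n)) := by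
  simp only [differentiable_pi, Fmap_apply]
  intro i j k l
  fun_prop

lemma fderiv_Fmap_apply (u v : (Fin n → Fin n → ℝ) × (Fin n → ℝ)) (i j k l : Fin n) :
    fderiv ℝ Fmap u v i j k l =
      ∑ p, ((v.1 i p * u.1 j p * u.1 k p * u.1 l p + u.1 i p * v.1 j p * u.1 k p * u.1 l p +
        u.1 i p * u.1 j p * v.1 k p * u.1 l p + u.1 i p * u.1 j p * u.1 k p * v.1 l p) * u.2 p +
          u.1 i p * u.1 j p * u.1 k p * u.1 l p * v.2 p) := by
  have hline : HasDerivAt (fun t : ℝ => u + t • v) v 0 := by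
    simpa using ((hasDerivAt_id (0 : ℝ)).smul_const v).const_add u
  have h₁ : HasDerivAt (fun t : ℝ => Fmap (u + t • v)) (fderiv ℝ Fmap u v) 0 :=
    HasFDerivAt.comp_hasDerivAt_of_eq 0 (differentiable_Fmap u).hasFDerivAt hline (by simp)
  have h₂ := hasDerivAt_pi.1 (hasDerivAt_pi.1 (hasDerivAt_pi.1 (hasDerivAt_pi.1 h₁ i) j) k) l
  have hQ : ∀ a p, HasDerivAt (fun t : ℝ => u.1 a p + t * v.1 a p) (v.1 a p) 0 := fun a p => by
    simpa using ((hasDerivAt_id (0 : ℝ)).mul_const (v.1 a p)).const_add (u.1 a p)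
  have hS : ∀ p, HasDerivAt (fun t : ℝ => u.2 p + t * v.2 p) (v.2 p) 0 := fun p => by
    simpa using ((hasDerivAt_id (0 : ℝ)).mul_const (v.2 p)).const_add (u.2 p)
  have h₃ := HasDerivAt.fun_sum (u := Finset.univ) fun p _ =>
    ((((hQ i p).fun_mul (hQ j p)).fun_mul (hQ k p)).fun_mul (hQ l p)).fun_mul (hS p)
  simp only [Fmap_apply, Prod.fst_add, Prod.snd_add, Prod.smul_fst, Prod.smul_snd, Pi.add_apply,
    Pi.smul_apply, smul_eq_mul] at h₂
  rw [h₂.unique h₃]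
  refine Finset.sum_congr rfl fun p _ => ?_
  ring

lemma fderiv_Fmap_dirS (u : (Fin n → Fin n → ℝ) × (Fin n → ℝ)) (p : Fin n) :
    fderiv ℝ Fmap u (dirS p) =
      outerT (fun i => u.1 i p) (fun i => u.1 i p) (fun i => u.1 i p) (fun i => u.1 i p) := by
  ext i j k l
  simp [fderiv_Fmap_apply, dirS, outerT, Pi.single_apply]

lemma fderiv_Fmap_dirQ (u : (Fin n → Fin n → ℝ) × (Fin n → ℝ)) (a p : Fin n) :
    fderiv ℝ Fmap u (dirQ a p) =
      u.2 p • outerT (Pi.single a 1) (fun i => u.1 i p) (fun i => u.1 i p) (fun i => u.1 i p) +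
      u.2 p • outerT (fun i => u.1 i p) (Pi.single a 1) (fun i => u.1 i p) (fun i => u.1 i p) +
      u.2 p • outerT (fun i => u.1 i p) (fun i => u.1 i p) (Pi.single a 1) (fun i => u.1 i p) +
      u.2 p • outerT (fun i => u.1 i p) (fun i => u.1 i p) (fun i => u.1 i p) (Pi.single a 1) := by
  ext i j k l
  rw [fderiv_Fmap_apply, Finset.sum_eq_single p]
  · simp only [dirQ, outerT, Pi.single_apply, Pi.add_apply, Pi.smul_apply, smul_eq_mul,
      Pi.zero_apply, and_true]
    ring
  · intro b _ hb
    simp [dirQ, hb]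
  · simp

lemma l2Sq_single_one (a : Fin n) : l2Sq (Pi.single a 1 : Fin n → ℝ) = 1 := by
  simp [l2Sq, Pi.single_apply]

lemma inOmega.l2Sq_col {εS : ℝ} {u : (Fin n → Fin n → ℝ) × (Fin n → ℝ)} (hu : inOmega εS u)
    (p : Fin n) : l2Sq (fun i => u.1 i p) = 1 := by
  have := congrFun (congrFun hu.1 p) p
  simpa [Matrix.mul_apply, l2Sq, sq] using this

lemma frobSq_diagT (d : Fin n → ℝ) : frobSq (diagT d) = ∑ i, d i ^ 2 := by
  simp [frobSq, diagT, ite_and]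

lemma paramNormSq_nonneg (u : (Fin n → Fin n → ℝ) × (Fin n → ℝ)) : 0 ≤ paramNormSq u := by
  unfold paramNormSq
  positivity

lemma paramNormSq_eq_sum_col (u : (Fin n → Fin n → ℝ) × (Fin n → ℝ)) :
    paramNormSq u = ∑ p, l2Sq (fun i => u.1 i p) + ∑ p, u.2 p ^ 2 := by
  simp only [paramNormSq, l2Sq]
  rw [Finset.sum_comm]

lemma frobSq_fderiv_sub_dirS_le {εS : ℝ} {u u' : (Fin n → Fin n → ℝ) × (Fin n → ℝ)}
    (hu : inOmega εS u) (hu' : inOmega εS u') (p : Fin n) :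
    frobSq ((fderiv ℝ Fmap u - fderiv ℝ Fmap u') (dirS p)) ≤
      16 * l2Sq (fun i => (u - u').1 i p) := by
  have h := hu.l2Sq_col p
  have h' := hu'.l2Sq_col p
  rw [_root_.sub_apply, fderiv_Fmap_dirS, fderiv_Fmap_dirS]
  refine (frobSq_outerT_sub_le h h h h' h' h').trans_eq ?_
  change 4 * (l2Sq (fun i => (u - u').1 i p) + l2Sq (fun i => (u - u').1 i p) +
    l2Sq (fun i => (u - u').1 i p) + l2Sq (fun i => (u - u').1 i p)) = _
  ring

lemma frobSq_fderiv_sub_dirQ_le {εS : ℝ} {u u' : (Fin n → Fin n → ℝ) × (Fin n → ℝ)}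
    (hu : inOmega εS u) (hu' : inOmega εS u') (a p : Fin n) :
    frobSq ((fderiv ℝ Fmap u - fderiv ℝ Fmap u') (dirQ a p)) ≤
      32 * ((u - u').2 p ^ 2 + 12 * u'.2 p ^ 2 * l2Sq (fun i => (u - u').1 i p)) := by
  have h := hu.l2Sq_col p
  have h' := hu'.l2Sq_col p
  have he := l2Sq_single_one a
  have hz : l2Sq ((Pi.single a 1 : Fin n → ℝ) - Pi.single a 1) = 0 := by simp [l2Sq]
  rw [_root_.sub_apply, fderiv_Fmap_dirQ, fderiv_Fmap_dirQ, add_sub_add_comm,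
    add_sub_add_comm, add_sub_add_comm]
  refine (frobSq_add_four_le _ _ _ _).trans ?_
  have h₁ := frobSq_smul_outerT_sub_le (d' := fun i => u'.1 i p) (u.2 p) (u'.2 p) he h h h he h' h'
  have h₂ := frobSq_smul_outerT_sub_le (d' := fun i => u'.1 i p) (u.2 p) (u'.2 p) h he h h h' he h'
  have h₃ := frobSq_smul_outerT_sub_le (d' := fun i => u'.1 i p) (u.2 p) (u'.2 p) h h he h h' h' he
  have h₄ := frobSq_smul_outerT_sub_le (d' := Pi.single a 1) (u.2 p) (u'.2 p) h h h he h' h' h'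
  have hcol : l2Sq ((fun i => u.1 i p) - fun i => u'.1 i p) =
    l2Sq (fun i => (u - u').1 i p) := rfl
  have hsub : (u - u').2 p = u.2 p - u'.2 p := rfl
  rw [hz, hcol] at h₁ h₂ h₃ h₄
  rw [hsub]
  linarith

end

/-- Bounded curvature, Lemma A.3.  For u, u' ∈ Ω with
‖S‖_F ≤ R and ‖u − u'‖₂ ≤ 2ε₀, the Jacobian of f is Lipschitz:
‖Df_u − Df_{u'}‖_F ≤ 2C₁·‖u − u'‖₂ with C₁ = n²(n+1)²·max{3R,1}. -/
theorem bounded_curvature (n : ℕ) (εS R ε₀ : ℝ)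
    (hεS : 0 < εS) (hR : 0 < R) (hε₀ : 0 < ε₀)
    (u u' : (Fin n → Fin n → ℝ) × (Fin n → ℝ))
    (hu : inOmega εS u) (hu' : inOmega εS u')
    (hSu : frob (diagT u.2) ≤ R) (hSu' : frob (diagT u'.2) ≤ R)
    (hclose : paramNorm (u - u') ≤ 2 * ε₀) :
    jacFrob (fderiv ℝ Fmap u - fderiv ℝ Fmap u') ≤
      2 * ((n : ℝ) ^ 2 * ((n : ℝ) + 1) ^ 2 * max (3 * R) 1) * paramNorm (u - u') := by
  have hM₁ : 1 ≤ max (3 * R) 1 := le_max_right _ _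
  have hMR : 3 * R ≤ max (3 * R) 1 := le_max_left _ _
  set M := max (3 * R) 1
  have hS' : ∀ p, 9 * u'.2 p ^ 2 ≤ M ^ 2 := fun p => by
    have h₁ : ∑ i, u'.2 i ^ 2 ≤ R ^ 2 := frobSq_diagT u'.2 ▸ (Real.sqrt_le_left hR.le).1 hSu'
    have h₂ : u'.2 p ^ 2 ≤ ∑ i, u'.2 i ^ 2 :=
      Finset.single_le_sum (f := fun i => u'.2 i ^ 2) (fun i _ => sq_nonneg _) (Finset.mem_univ p)
    nlinarith
  have hM₂ : 1 ≤ M ^ 2 := one_le_pow₀ hM₁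
  have hcol : ∀ p, 0 ≤ l2Sq (fun i => (u - u').1 i p) := fun p => l2Sq_nonneg _
  have hcols : 0 ≤ ∑ p, l2Sq (fun i => (u - u').1 i p) := Finset.sum_nonneg fun p _ => hcol p
  have hdiag : 0 ≤ ∑ p, (u - u').2 p ^ 2 := Finset.sum_nonneg fun p _ => sq_nonneg _
  have hD := paramNormSq_eq_sum_col (u - u')
  have hQ : ∑ a, ∑ p, frobSq ((fderiv ℝ Fmap u - fderiv ℝ Fmap u') (dirQ a p)) ≤
      n * (44 * M ^ 2 * paramNormSq (u - u')) := by
    have h : ∀ a : Fin n, ∑ p, frobSq ((fderiv ℝ Fmap u - fderiv ℝ Fmap u') (dirQ a p)) ≤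
        44 * M ^ 2 * paramNormSq (u - u') := fun a => by
      rw [hD, ← Finset.sum_add_distrib, Finset.mul_sum]
      refine Finset.sum_le_sum fun p _ => (frobSq_fderiv_sub_dirQ_le hu hu' a p).trans ?_
      have h₁ := mul_le_mul_of_nonneg_right (hS' p) (hcol p)
      have h₂ := mul_le_mul_of_nonneg_right hM₂ (sq_nonneg ((u - u').2 p))
      have h₃ := mul_nonneg (sq_nonneg M) (hcol p)
      have h₄ := mul_nonneg (sq_nonneg M) (sq_nonneg ((u - u').2 p))
      nlinarith
    simpa using Finset.sum_le_sum fun a (_ : a ∈ Finset.univ) => h a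
  have hS : ∑ p, frobSq ((fderiv ℝ Fmap u - fderiv ℝ Fmap u') (dirS p)) ≤
      n * (16 * M ^ 2 * paramNormSq (u - u')) := by
    rcases Nat.eq_zero_or_pos n with rfl | hn
    · simp
    have hn : (1 : ℝ) ≤ n := by exact_mod_cast hn
    calc _ ≤ 16 * ∑ p, l2Sq (fun i => (u - u').1 i p) := by
          rw [Finset.mul_sum]
          exact Finset.sum_le_sum fun p _ => frobSq_fderiv_sub_dirS_le hu hu' p
      _ ≤ 16 * paramNormSq (u - u') := by linarith
      _ ≤ 16 * M ^ 2 * paramNormSq (u - u') := by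
          nlinarith [mul_le_mul_of_nonneg_right hM₂ (paramNormSq_nonneg (u - u'))]
      _ ≤ _ := le_mul_of_one_le_left
          (mul_nonneg (by positivity) (paramNormSq_nonneg _)) hn
  have hconst : (60 : ℝ) * n ≤ (2 * (n ^ 2 * (n + 1) ^ 2)) ^ 2 := by
    rcases Nat.eq_zero_or_pos n with rfl | hn
    · simp
    have hn : (1 : ℝ) ≤ n := by exact_mod_cast hn
    calc (60 : ℝ) * n ≤ 4 * (n ^ 4 * 2 ^ 4) := by
          nlinarith [le_self_pow₀ hn (by norm_num : 4 ≠ 0)]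
      _ ≤ 4 * (n ^ 4 * (n + 1) ^ 4) := by gcongr; linarith
      _ = _ := by ring
  unfold jacFrob paramNorm
  refine (Real.sqrt_le_left (by positivity)).2 ?_
  rw [mul_pow, Real.sq_sqrt (paramNormSq_nonneg _)]
  have h := mul_le_mul_of_nonneg_right hconst
    (mul_nonneg (sq_nonneg M) (paramNormSq_nonneg (u - u')))
  linarith
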